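/- Suppose there exists M₀ ∈ Γ₀ such that the matrix M₀^{-1}B^{-1}M₀^δ B does not have 1 as an eigenvalue. Then the smallest normal subgroup of Γ containing T_B is the full translation group {g(u,v,I) : u, v ∈ K^n}; in fact, T_B intersects its conjugate g(0,0,M₀) T_B g(0,0,M₀)^{-1} trivially and together with this conjugate generates {g(u,v,I) : u, v ∈ K^n}. -/

import Mathlib

open Matrix

/-- The block matrix `g(u,v,M)` (with `Md = M^δ`): block rows `(1,0,0)`, `(u,M,0)`, `(v,0,Md)`. -/
def gmat {K : Type*} [Field K] {n : ℕ} (u v : Fin n → K)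
    (M Md : Matrix (Fin n) (Fin n) K) :
    Matrix (Unit ⊕ Fin n ⊕ Fin n) (Unit ⊕ Fin n ⊕ Fin n) K :=
  Matrix.fromBlocks 1 0 (Matrix.of fun i _ => Sum.elim u v i) (Matrix.fromBlocks M 0 0 Md)

/-- The underlying matrix of an element of a subgroup of `GL (Fin n) K`. -/
def mOf {K : Type*} [Field K] {n : ℕ} {Γ₀ : Subgroup (GL (Fin n) K)} (M : Γ₀) :
    Matrix (Fin n) (Fin n) K := ((M : GL (Fin n) K) : Matrix (Fin n) (Fin n) K)

section BlockMatrices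

variable {K : Type*} [Field K] {n : ℕ}

lemma gmat_mul (u v u' v' : Fin n → K) (M Md M' Md' : Matrix (Fin n) (Fin n) K) :
    gmat u v M Md * gmat u' v' M' Md' =
      gmat (u + M *ᵥ u') (v + Md *ᵥ v') (M * M') (Md * Md') := by
  unfold gmat
  rw [fromBlocks_multiply, fromBlocks_multiply]
  congr 1
  · simp
  · simp
  · ext i j
    rcases i with i | i <;> simp [Matrix.mul_apply, mulVec, dotProduct]
  · simp

lemma gmat_zero_one : gmat (0 : Fin n → K) 0 1 1 = 1 := by
  unfold gmat
  have hzero : (of fun (i : Fin n ⊕ Fin n) (_ : Unit) =>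
      Sum.elim (0 : Fin n → K) (0 : Fin n → K) i) = 0 := by
    ext i j
    rcases i with i | i <;> simp
  rw [hzero, fromBlocks_one, fromBlocks_one]

lemma gmat_translation_inj {u v u' v' : Fin n → K} {M Md M' Md' : Matrix (Fin n) (Fin n) K}
    (h : gmat u v M Md = gmat u' v' M' Md') : u = u' ∧ v = v' := by
  constructor
  · funext i
    simpa [gmat] using congrFun (congrFun h (Sum.inr (Sum.inl i))) (Sum.inl ())
  · funext i
    simpa [gmat] using congrFun (congrFun h (Sum.inr (Sum.inr i))) (Sum.inl ())

lemma isUnit_det_gmat (u v : Fin n → K) {M Md : Matrix (Fin n) (Fin n) K}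
    (hM : IsUnit M.det) (hMd : IsUnit Md.det) : IsUnit (gmat u v M Md).det := by
  unfold gmat
  rw [det_fromBlocks_zero₁₂, det_fromBlocks_zero₁₂, det_one, one_mul]
  exact hM.mul hMd

lemma gmat_conj (u v a b : Fin n → K) {M Md : Matrix (Fin n) (Fin n) K}
    (hM : IsUnit M.det) (hMd : IsUnit Md.det) :
    gmat u v M Md * gmat a b 1 1 * (gmat u v M Md)⁻¹ = gmat (M *ᵥ a) (Md *ᵥ b) 1 1 := by
  have hcomm : gmat u v M Md * gmat a b 1 1 =
      gmat (M *ᵥ a) (Md *ᵥ b) 1 1 * gmat u v M Md := by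
    simp [gmat_mul, add_comm]
  rw [hcomm, mul_nonsing_inv_cancel_right _ _ (isUnit_det_gmat u v hM hMd)]

lemma gmat_one_inv (u v : Fin n → K) : (gmat u v 1 1)⁻¹ = gmat (-u) (-v) 1 1 :=
  inv_eq_right_inv (by simp [gmat_mul, gmat_zero_one])

lemma isUnit_det_mOf {Γ₀ : Subgroup (GL (Fin n) K)} (M : Γ₀) : IsUnit (mOf M).det :=
  (isUnit_iff_isUnit_det _).1 (M : GL (Fin n) K).isUnit

lemma mOf_mul_mOf_inv {Γ₀ : Subgroup (GL (Fin n) K)} (M : Γ₀) : mOf M * mOf M⁻¹ = 1 := by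
  simp [mOf]

end BlockMatrices

theorem stmt5 (K : Type*) [Field K] (n : ℕ) (hn : 1 ≤ n)
    (Γ₀ : Subgroup (GL (Fin n) K)) (δ : Γ₀ →* Γ₀) (A B : GL (Fin n) K)
    (M₀ : Γ₀)
    -- M₀⁻¹B⁻¹M₀^δB has no eigenvalue 1
    (h : (mOf (M₀⁻¹) * ((B⁻¹ : GL (Fin n) K) : Matrix (Fin n) (Fin n) K) * mOf (δ M₀) *
        (B : Matrix (Fin n) (Fin n) K) - 1).det ≠ 0) :
    -- notation: Γ, T_B, the conjugate C = g(0,0,M₀) T_B g(0,0,M₀)⁻¹,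
    -- and the full translation group T = {g(u,v,I)}
    let Γ : Set (Matrix (Unit ⊕ Fin n ⊕ Fin n) (Unit ⊕ Fin n ⊕ Fin n) K) :=
      {X | ∃ u v, ∃ M : Γ₀, X = gmat u v (mOf M) (mOf (δ M))}
    let TB : Set (Matrix (Unit ⊕ Fin n ⊕ Fin n) (Unit ⊕ Fin n ⊕ Fin n) K) :=
      {X | ∃ u : Fin n → K, X = gmat u ((B : Matrix (Fin n) (Fin n) K).mulVec u) 1 1}
    let C : Set (Matrix (Unit ⊕ Fin n ⊕ Fin n) (Unit ⊕ Fin n ⊕ Fin n) K) :=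
      {X | ∃ t ∈ TB, X = gmat 0 0 (mOf M₀) (mOf (δ M₀)) * t *
        (gmat 0 0 (mOf M₀) (mOf (δ M₀)))⁻¹}
    let T : Set (Matrix (Unit ⊕ Fin n ⊕ Fin n) (Unit ⊕ Fin n ⊕ Fin n) K) :=
      {X | ∃ u v : Fin n → K, X = gmat u v 1 1}
    -- T_B meets its conjugate trivially …
    (TB ∩ C = {1}) ∧
    -- … and together with it generates (indeed equals, after complex product) T
    (∀ X, X ∈ T ↔ ∃ a ∈ TB, ∃ b ∈ C, X = a * b) ∧
    -- T is a normal subgroup of Γ containing T_B …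
    TB ⊆ T ∧ T ⊆ Γ ∧ (1 : Matrix (Unit ⊕ Fin n ⊕ Fin n) (Unit ⊕ Fin n ⊕ Fin n) K) ∈ T ∧
    (∀ a ∈ T, ∀ b ∈ T, a * b ∈ T) ∧ (∀ a ∈ T, a⁻¹ ∈ T) ∧
    (∀ γ ∈ Γ, ∀ a ∈ T, γ * a * γ⁻¹ ∈ T) ∧
    -- … and any normal subgroup of Γ containing T_B contains T: T is the smallest one
    (∀ N : Set (Matrix (Unit ⊕ Fin n ⊕ Fin n) (Unit ⊕ Fin n ⊕ Fin n) K),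
      (1 : Matrix (Unit ⊕ Fin n ⊕ Fin n) (Unit ⊕ Fin n ⊕ Fin n) K) ∈ N →
      (∀ a ∈ N, ∀ b ∈ N, a * b ∈ N) → (∀ a ∈ N, a⁻¹ ∈ N) →
      (∀ γ ∈ Γ, ∀ a ∈ N, γ * a * γ⁻¹ ∈ N) → TB ⊆ N → T ⊆ N) := by
  intro Γ TB C T
  set D : Matrix (Fin n) (Fin n) K := mOf (δ M₀) * B - B * mOf M₀ with hD
  have hBB : (B : Matrix (Fin n) (Fin n) K) * ((B⁻¹ : GL (Fin n) K) : Matrix (Fin n) (Fin n) K) =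
      1 := Units.mul_inv B
  have hDfac : D = B * mOf M₀ * (mOf (M₀⁻¹) * ((B⁻¹ : GL (Fin n) K) : Matrix (Fin n) (Fin n) K) *
      mOf (δ M₀) * (B : Matrix (Fin n) (Fin n) K) - 1) := by
    have hcancel : (B : Matrix (Fin n) (Fin n) K) * mOf M₀ * (mOf (M₀⁻¹) *
        ((B⁻¹ : GL (Fin n) K) : Matrix (Fin n) (Fin n) K) * mOf (δ M₀) * B) =
        B * (mOf M₀ * mOf M₀⁻¹) * ((B⁻¹ : GL (Fin n) K) : Matrix (Fin n) (Fin n) K) *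
          mOf (δ M₀) * B := by
      simp only [Matrix.mul_assoc]
    rw [mul_sub, hcancel, mOf_mul_mOf_inv, mul_one, hBB, one_mul, mul_one]
  have hDdet : IsUnit D.det := by
    rw [hDfac, det_mul, det_mul]
    exact (((isUnit_iff_isUnit_det _).1 B.isUnit).mul (isUnit_det_mOf M₀)).mul h.isUnit
  have hC : ∀ X, X ∈ C ↔ ∃ u : Fin n → K,
      X = gmat (mOf M₀ *ᵥ u) (mOf (δ M₀) *ᵥ ((B : Matrix (Fin n) (Fin n) K) *ᵥ u)) 1 1 := by
    intro X
    constructor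
    · rintro ⟨_, ⟨u, rfl⟩, rfl⟩
      exact ⟨u, gmat_conj _ _ _ _ (isUnit_det_mOf _) (isUnit_det_mOf _)⟩
    · rintro ⟨u, rfl⟩
      exact ⟨_, ⟨u, rfl⟩, (gmat_conj _ _ _ _ (isUnit_det_mOf _) (isUnit_det_mOf _)).symm⟩
  have hTprod : ∀ X ∈ T, ∃ a ∈ TB, ∃ b ∈ C, X = a * b := by
    rintro _ ⟨u, v, rfl⟩
    obtain ⟨b, hb⟩ : ∃ b, D *ᵥ b = v - (B : Matrix (Fin n) (Fin n) K) *ᵥ u :=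
      ⟨D⁻¹ *ᵥ (v - (B : Matrix (Fin n) (Fin n) K) *ᵥ u), by
        rw [mulVec_mulVec, mul_nonsing_inv _ hDdet, one_mulVec]⟩
    refine ⟨_, ⟨u - mOf M₀ *ᵥ b, rfl⟩, _, (hC _).2 ⟨b, rfl⟩, ?_⟩
    rw [hD, sub_mulVec, ← mulVec_mulVec, ← mulVec_mulVec] at hb
    rw [gmat_mul, one_mulVec, one_mulVec, mul_one, sub_add_cancel, mulVec_sub,
      sub_add_eq_add_sub, add_sub_assoc, hb, add_sub_cancel]
  have hTBT : TB ⊆ T := by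
    rintro _ ⟨u, rfl⟩
    exact ⟨_, _, rfl⟩
  have hCT : C ⊆ T := by
    intro X hX
    obtain ⟨u, rfl⟩ := (hC X).1 hX
    exact ⟨_, _, rfl⟩
  have hTmul : ∀ a ∈ T, ∀ b ∈ T, a * b ∈ T := by
    rintro _ ⟨u, v, rfl⟩ _ ⟨u', v', rfl⟩
    exact ⟨u + u', v + v', by simp [gmat_mul]⟩
  refine ⟨?_, fun X => ⟨hTprod X, ?_⟩, hTBT, ?_, ⟨0, 0, gmat_zero_one.symm⟩, hTmul, ?_, ?_, ?_⟩
  · ext X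
    constructor
    · rintro ⟨⟨w, rfl⟩, hX⟩
      obtain ⟨u, hu⟩ := (hC _).1 hX
      obtain ⟨rfl, h₂⟩ := gmat_translation_inj hu
      have hDu : D *ᵥ u = 0 := by
        rw [hD, sub_mulVec, ← mulVec_mulVec, ← mulVec_mulVec, h₂, sub_self]
      have hu0 : u = 0 := eq_zero_of_mulVec_eq_zero hDdet.ne_zero hDu
      simp [hu0, gmat_zero_one]
    · rintro rfl
      exact ⟨⟨0, by simp [gmat_zero_one]⟩, (hC 1).2 ⟨0, by simp [gmat_zero_one]⟩⟩
  · rintro ⟨a, ha, b, hb, rfl⟩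
    exact hTmul a (hTBT ha) b (hCT hb)
  · rintro _ ⟨u, v, rfl⟩
    exact ⟨u, v, 1, by simp [mOf]⟩
  · rintro _ ⟨u, v, rfl⟩
    exact ⟨-u, -v, gmat_one_inv u v⟩
  · rintro _ ⟨u, v, M, rfl⟩ _ ⟨a, b, rfl⟩
    exact ⟨_, _, gmat_conj _ _ _ _ (isUnit_det_mOf _) (isUnit_det_mOf _)⟩
  · intro N _ hmul _ hconj hTBN X hX
    obtain ⟨a, ha, _, ⟨t, ht, rfl⟩, rfl⟩ := hTprod X hX
    exact hmul a (hTBN ha) _ (hconj _ ⟨0, 0, M₀, rfl⟩ t (hTBN ht))
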